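/- Let 𝓕 ⊆ 2^[n] be s-extremal and X ⊆ [n]. Then the projection 𝓕|_X = {F ∩ X : F ∈ 𝓕} is s-extremal, and moreover for every Y ⊆ X one has Y ∈ Sh(𝓕|_X) if and only if Y ∈ Sh(𝓕); in particular Sh(𝓕|_X) = {Y ∈ Sh(𝓕) : Y ⊆ X}. -/

import Mathlib

open Finset

/-- The family of subsets of `[n]` (identified with `Fin n`) shattered by the
set system `F ⊆ 2^[n]`. -/
def Sh (n : ℕ) (F : Finset (Finset (Fin n))) : Finset (Finset (Fin n)) :=
  Finset.univ.filter (fun S => ∀ H ∈ S.powerset, ∃ A ∈ F, A ∩ S = H)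

/-- A set system is shattering-extremal (s-extremal) if it shatters exactly
`|F|` sets. -/
def SExtremal (n : ℕ) (F : Finset (Finset (Fin n))) : Prop :=
  (Sh n F).card = F.card

/-- The inclusion graph of a set system: vertices are the members of `F`,
two sets adjacent iff their symmetric difference is a single element. -/
def inclGraph (n : ℕ) (F : Finset (Finset (Fin n))) : SimpleGraph {A // A ∈ F} where
  Adj A B := (symmDiff A.1 B.1).card = 1
  symm := by constructor; intro A B h; rwa [symmDiff_comm]
  loopless := by constructor; intro A h; simp [symmDiff_self] at h

/-- If `F` is s-extremal then so is the family obtained by erasing `a` from every member. -/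
theorem card_shatterer_image_erase {α : Type*} [DecidableEq α] {F : Finset (Finset α)}
    (hF : #F.shatterer = #F) (a : α) :
    #(F.image fun s => s.erase a).shatterer = #(F.image fun s => s.erase a) := by
  refine le_antisymm ?_ (card_le_card_shatterer _)
  set G := F.image fun s => s.erase a with hG
  set K := F.memberSubfamily a ∩ F.nonMemberSubfamily a with hK
  have hcard : #G + #K = #F := by
    rw [hG, ← memberSubfamily_union_nonMemberSubfamily, card_union_add_card_inter,
      card_memberSubfamily_add_card_nonMemberSubfamily]
  have hGa : ∀ s ∈ G.shatterer, a ∉ s := by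
    intro s hs ha
    obtain ⟨t, ht, hst⟩ := (mem_shatterer.1 hs).exists_superset
    obtain ⟨u, -, rfl⟩ := mem_image.1 ht
    exact notMem_erase a u (hst ha)
  have hKa : ∀ s ∈ K.shatterer, a ∉ s := by
    intro s hs ha
    obtain ⟨t, ht, hst⟩ := (mem_shatterer.1 hs).exists_superset
    exact (mem_memberSubfamily.1 (mem_inter.1 ht).1).2 (hst ha)
  have hinj : Set.InjOn (insert a) (K.shatterer : Set (Finset α)) := by
    intro s hs t ht hst
    rw [← erase_insert (hKa s hs), ← erase_insert (hKa t ht)]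
    exact congrArg (fun u => u.erase a) hst
  have hdisj : Disjoint G.shatterer (K.shatterer.image (insert a)) := by
    rw [disjoint_left]
    intro s hs hs'
    obtain ⟨t, -, rfl⟩ := mem_image.1 hs'
    exact hGa _ hs (mem_insert_self a t)
  have hsub : G.shatterer ∪ K.shatterer.image (insert a) ⊆ F.shatterer := by
    intro s hs
    rw [mem_shatterer]
    intro t hts
    rcases mem_union.1 hs with hs | hs
    · have ha := hGa s hs
      obtain ⟨u, hu, hut⟩ := mem_shatterer.1 hs hts
      obtain ⟨v, hv, rfl⟩ := mem_image.1 hu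
      exact ⟨v, hv, by rw [← hut, inter_erase, erase_eq_of_notMem (by simp [ha])]⟩
    · obtain ⟨r, hr, rfl⟩ := mem_image.1 hs
      have ha := hKa r hr
      obtain ⟨u, hu, hut⟩ := mem_shatterer.1 hr (show t.erase a ⊆ r from by grind)
      obtain ⟨hu₁, hu₂⟩ := mem_inter.1 hu
      rw [mem_memberSubfamily] at hu₁
      rw [mem_nonMemberSubfamily] at hu₂
      by_cases hat : a ∈ t
      · refine ⟨insert a u, hu₁.1, ?_⟩
        rw [← insert_inter_distrib, hut, insert_erase hat]
      · refine ⟨u, hu₂.1, ?_⟩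
        rw [insert_inter_of_notMem hu₂.2, hut, erase_eq_of_notMem hat]
  have hle := card_le_card hsub
  rw [card_union_of_disjoint hdisj, card_image_of_injOn hinj] at hle
  have := card_le_card_shatterer K
  lia

/-- If `F` is s-extremal then so is the family obtained by removing `T` from every member. -/
theorem card_shatterer_image_sdiff {α : Type*} [DecidableEq α] {F : Finset (Finset α)}
    (hF : #F.shatterer = #F) (T : Finset α) :
    #(F.image fun s => s \ T).shatterer = #(F.image fun s => s \ T) := by
  induction T using Finset.induction_on with
  | empty => simpa using hF
  | insert a T _ ih =>
    have : (F.image fun s => s \ insert a T) =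
        (F.image fun s => s \ T).image fun s => s.erase a := by
      simp [image_image, Function.comp_def, sdiff_insert]
    rw [this]
    exact card_shatterer_image_erase ih a

theorem mem_Sh {n : ℕ} {F : Finset (Finset (Fin n))} {S : Finset (Fin n)} :
    S ∈ Sh n F ↔ F.Shatters S := by
  simp [Sh, Shatters, inter_comm]

theorem Sh_eq_shatterer (n : ℕ) (F : Finset (Finset (Fin n))) : Sh n F = F.shatterer := by
  ext S
  rw [mem_Sh, mem_shatterer]

theorem shatters_image_inter_iff {α : Type*} [DecidableEq α] {F : Finset (Finset α)}
    {X Y : Finset α} (hY : Y ⊆ X) : (F.image fun A => A ∩ X).Shatters Y ↔ F.Shatters Y := by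
  have h (A : Finset α) : Y ∩ (A ∩ X) = Y ∩ A := by grind
  simp [Shatters, h]

theorem subset_of_shatters_image_inter {α : Type*} [DecidableEq α] {F : Finset (Finset α)}
    {X Y : Finset α} (hY : (F.image fun A => A ∩ X).Shatters Y) : Y ⊆ X := by
  obtain ⟨t, ht, hst⟩ := hY.exists_superset
  obtain ⟨u, -, rfl⟩ := mem_image.1 ht
  exact hst.trans inter_subset_right

/-- Projections of s-extremal systems are s-extremal, and a
subset `Y ⊆ X` is shattered by the projection `F|_X` iff it is shattered by
`F`; consequently `Sh(F|_X) = { Y ∈ Sh(F) : Y ⊆ X }`. -/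
theorem stmt13 (n : ℕ) (F : Finset (Finset (Fin n))) (hext : SExtremal n F)
    (X : Finset (Fin n)) :
    SExtremal n (F.image (fun A => A ∩ X)) ∧
    (∀ Y ⊆ X, (Y ∈ Sh n (F.image (fun A => A ∩ X)) ↔ Y ∈ Sh n F)) ∧
    Sh n (F.image (fun A => A ∩ X)) = (Sh n F).filter (fun Y => Y ⊆ X) := by
  have hiff : ∀ Y ⊆ X, (Y ∈ Sh n (F.image (fun A => A ∩ X)) ↔ Y ∈ Sh n F) := by
    intro Y hY
    rw [mem_Sh, mem_Sh, shatters_image_inter_iff hY]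
  refine ⟨?_, hiff, ?_⟩
  · rw [SExtremal, Sh_eq_shatterer] at hext ⊢
    simpa [sdiff_compl] using card_shatterer_image_sdiff hext Xᶜ
  · ext Y
    rw [mem_filter]
    refine ⟨fun h => ?_, fun h => (hiff Y h.2).2 h.1⟩
    have hY := subset_of_shatters_image_inter (mem_Sh.1 h)
    exact ⟨(hiff Y hY).1 h, hY⟩
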